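/- Let μ be the stationary Markov measure on {a,b}^ℕ with transition probabilities p_{aa} = p, p_{bb} = q, 0 < p,q < 1, and let f be the run-length encoder. Then for μ⊗μ-almost every pair of sequences (x,y), lim_{n→∞} M^RLE_n(x,y)/log n = 4 / log( (1+p)(1+q) / ((1−p)(1−q)) ). -/

import Mathlib

open MeasureTheory Filter Topology

section RLEDefs

variable {A : Type*}

/-- The starting position of the run following the run that starts at position `i`:
the least index `> i` where the value of `x` changes (with the junk convention `i + 1`
if the sequence is constant from position `i` on). -/
noncomputable def nextChange (x : ℕ → A) (i : ℕ) : ℕ := by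
  classical
  exact if h : ∃ j, x (i + j + 1) ≠ x i then i + Nat.find h + 1 else i + 1

/-- Starting position of the `n`-th maximal run of the sequence `x`. -/
noncomputable def runStart (x : ℕ → A) : ℕ → ℕ
  | 0 => 0
  | n + 1 => nextChange x (runStart x n)

/-- The run-length encoder `f : A^ℕ → (A × ℕ)^ℕ`: the `n`-th symbol of `f x` is the pair
(value of the `n`-th maximal run of `x`, length of that run). -/
noncomputable def rle (x : ℕ → A) (n : ℕ) : A × ℕ :=
  (x (runStart x n), runStart x (n + 1) - runStart x n)

/-- `M_n(u,v)`: the length of the longest common substring of `u` and `v`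
occurring within their first `n` symbols, i.e.
`max {k : u_i^{i+k-1} = v_j^{j+k-1} for some 0 ≤ i,j ≤ n-k}`. -/
noncomputable def matchLen {C : Type*} (u v : ℕ → C) (n : ℕ) : ℕ :=
  sSup {k | ∃ i j, i + k ≤ n ∧ j + k ≤ n ∧ ∀ m < k, u (i + m) = v (j + m)}

/-- `M^RLE_n(x,y) = M_n(f x, f y)`. -/
noncomputable def MRLE (x y : ℕ → A) (n : ℕ) : ℕ := matchLen (rle x) (rle y) n

/-- `M̃_n(x,y) = max {k : f(σ^i x)_1^k = f(σ^j y)_1^k for some 0 ≤ i,j ≤ n-k}`. -/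
noncomputable def Mtilde (x y : ℕ → A) (n : ℕ) : ℕ :=
  sSup {k | ∃ i j, i + k ≤ n ∧ j + k ≤ n ∧
    ∀ m < k, rle (fun t => x (t + i)) m = rle (fun t => y (t + j)) m}

/-- The number of maximal runs in the first `n` symbols of `x`, i.e. `|f(x_1^n)|`. -/
noncomputable def runCount (x : ℕ → A) (n : ℕ) : ℕ := by
  classical
  exact ((Finset.range n).filter fun i => i = 0 ∨ x i ≠ x (i - 1)).card

/-- The left shift `σ` on sequences. -/
def shift (x : ℕ → A) : ℕ → A := fun n => x (n + 1)

variable [MeasurableSpace A]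

/-- `Σ_{ω ∈ B^n} (f_*μ)(ω)²`: the sum, over all cylinders `ω` of length `n` in
`B^ℕ = (A × ℕ)^ℕ`, of the squared measure of `f⁻¹ω` (where `f` is the run-length
encoder), i.e. of the squared pushforward measure of the cylinder. -/
noncomputable def pushCylSum (μ : Measure (ℕ → A)) (n : ℕ) : ℝ :=
  ∑' ω : Fin n → A × ℕ, ((μ {x | ∀ i : Fin n, rle x i = ω i}).toReal) ^ 2

/-- Lower Rényi entropy of order 2 of the pushforward measure `f_*μ`:
`H̲₂(f_*μ) = - liminf_n (1/n) log Σ_ω (f_*μ)(ω)²`. -/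
noncomputable def H2lower (μ : Measure (ℕ → A)) : ℝ :=
  -liminf (fun n : ℕ => Real.log (pushCylSum μ n) / n) atTop

/-- Upper Rényi entropy of order 2 of the pushforward measure `f_*μ`:
`H̄₂(f_*μ) = - limsup_n (1/n) log Σ_ω (f_*μ)(ω)²`. -/
noncomputable def H2upper (μ : Measure (ℕ → A)) : ℝ :=
  -limsup (fun n : ℕ => Real.log (pushCylSum μ n) / n) atTop

/-- Hypothesis (A): there are `c > 0`, `h > 0` with `μ(a…a) ≤ c e^{-hn}` for every
constant cylinder `a…a` of length `n`. -/
def HypA (μ : Measure (ℕ → A)) (c h : ℝ) : Prop :=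
  0 < c ∧ 0 < h ∧
    ∀ (n : ℕ) (a : A), μ {x | ∀ i < n, x i = a} ≤ ENNReal.ofReal (c * Real.exp (-h * n))

/-- The σ-algebra `F_0^n` generated by the coordinates `X_0, …, X_n`. -/
def cylAlgLE (A : Type*) [MeasurableSpace A] (n : ℕ) : MeasurableSpace (ℕ → A) :=
  MeasurableSpace.comap (fun x (i : Fin (n + 1)) => x i) inferInstance

/-- The σ-algebra `F_m^∞` generated by the coordinates `X_m, X_{m+1}, …`. -/
def cylAlgGE (A : Type*) [MeasurableSpace A] (m : ℕ) : MeasurableSpace (ℕ → A) :=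
  MeasurableSpace.comap (fun x (i : ℕ) => x (m + i)) inferInstance

/-- α-mixing with rate function `a`: for all `n, g` and all `S ∈ F_0^n`, `T ∈ F_{n+g}^∞`,
`|μ(S ∩ T) - μ(S)μ(T)| ≤ a(g)`. -/
def AlphaMixingBound (μ : Measure (ℕ → A)) (a : ℕ → ℝ) : Prop :=
  ∀ (n g : ℕ) (S T : Set (ℕ → A)),
    MeasurableSet[cylAlgLE A n] S → MeasurableSet[cylAlgGE A (n + g)] T →
    |(μ (S ∩ T)).toReal - (μ S).toReal * (μ T).toReal| ≤ a g

/-- α-mixing with exponential decay. -/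
def AlphaMixingExp (μ : Measure (ℕ → A)) : Prop :=
  ∃ C θ : ℝ, 0 < C ∧ 0 < θ ∧ AlphaMixingBound μ fun g => C * Real.exp (-θ * g)

/-- ψ-mixing with polynomial rate `ψ(g) = g^{-a}`: for all `n` and `g ≥ 1` and all
`S ∈ F_0^n`, `T ∈ F_{n+g}^∞`, `|μ(S ∩ T) - μ(S)μ(T)| ≤ g^{-a} μ(S) μ(T)`. -/
def PsiMixingPoly (μ : Measure (ℕ → A)) (a : ℝ) : Prop :=
  ∀ (n g : ℕ), 1 ≤ g → ∀ (S T : Set (ℕ → A)),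
    MeasurableSet[cylAlgLE A n] S → MeasurableSet[cylAlgGE A (n + g)] T →
    |(μ (S ∩ T)).toReal - (μ S).toReal * (μ T).toReal| ≤
      (g : ℝ) ^ (-a) * (μ S).toReal * (μ T).toReal

/-- `S_n = Σ_{0 ≤ i,j ≤ n-1} 1_{A_{i,j}}` with `A_{i,j} = {f(σ^i X)_1^k = f(σ^j Y)_1^k}`,
seen as a random variable on the product space (X = first coordinate, Y = second). -/
noncomputable def Sn (k n : ℕ) (p : (ℕ → A) × (ℕ → A)) : ℝ := by
  classical
  exact ∑ i ∈ Finset.range n, ∑ j ∈ Finset.range n,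
    if ∀ m < k, rle (fun t => p.1 (t + i)) m = rle (fun t => p.2 (t + j)) m then (1 : ℝ) else 0

end RLEDefs

def ralt (a : Bool) : ℕ → Bool
  | 0 => a
  | n + 1 => !(ralt a n)

theorem ralt_add (a : Bool) (i m : ℕ) : ralt a (i + m) = ralt (ralt a i) m := by
  induction m with
  | zero => rfl
  | succ m ih => rw [← add_assoc]; simp [ralt, ih]

theorem ralt_two_mul (a : Bool) (L : ℕ) : ralt a (2 * L) = a := by
  induction L with
  | zero => rfl
  | succ m ih => rw [mul_add, ralt_add, ih]; simp [ralt]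

theorem runStart_eq_of (x : ℕ → Bool) (a : Bool) (k : ℕ → ℕ) (m : ℕ)
    (hk : ∀ i < m, 1 ≤ k i)
    (hx : ∀ i < m, ∀ t, ∑ j ∈ Finset.range i, k j ≤ t → t < ∑ j ∈ Finset.range (i + 1), k j →
      x t = ralt a i)
    (hxm : x (∑ j ∈ Finset.range m, k j) = ralt a m) :
    ∀ i ≤ m, runStart x i = ∑ j ∈ Finset.range i, k j := by
  intro i
  induction i with
  | zero => intro _; simp [runStart]
  | succ i ih =>
    intro hi
    have h1 := ih (by omega)
    have hki := hk i (by omega)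
    have hs : ∑ j ∈ Finset.range (i + 1), k j = ∑ j ∈ Finset.range i, k j + k i :=
      Finset.sum_range_succ _ _
    have hxi : x (∑ j ∈ Finset.range i, k j) = ralt a i :=
      hx i (by omega) _ le_rfl (by omega)
    have hxi1 : x (∑ j ∈ Finset.range (i + 1), k j) = ralt a (i + 1) := by
      rcases Nat.lt_or_ge (i + 1) m with h | h
      · refine hx (i + 1) h _ le_rfl ?_
        rw [Finset.sum_range_succ _ (i + 1)]
        have := hk (i + 1) h
        omega
      · have : i + 1 = m := by omega
        rw [this, hxm]
    have hne : x (∑ j ∈ Finset.range i, k j + (k i - 1) + 1) ≠ x (∑ j ∈ Finset.range i, k j) := by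
      have e : ∑ j ∈ Finset.range i, k j + (k i - 1) + 1 = ∑ j ∈ Finset.range (i + 1), k j := by
        omega
      rw [e, hxi, hxi1]
      simp [ralt]
    rw [runStart, h1, nextChange]
    have hex : ∃ j, x (∑ j ∈ Finset.range i, k j + j + 1) ≠ x (∑ j ∈ Finset.range i, k j) :=
      ⟨_, hne⟩
    rw [dif_pos hex]
    have hf : Nat.find hex = k i - 1 := by
      rw [Nat.find_eq_iff]
      refine ⟨hne, ?_⟩
      intro n hn
      rw [not_not, hxi]
      exact hx i (by omega) _ (by omega) (by omega)
    have hf' : ∀ (inst : DecidablePred fun j =>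
        x (∑ j ∈ Finset.range i, k j + j + 1) ≠ x (∑ j ∈ Finset.range i, k j)),
        @Nat.find _ inst hex = k i - 1 := by
      intro inst
      rw [← hf]
      congr
    rw [hf', hs]
    omega

theorem rle_eq_of (x : ℕ → Bool) (a : Bool) (k : ℕ → ℕ) (m : ℕ)
    (hk : ∀ i < m, 1 ≤ k i)
    (hx : ∀ i < m, ∀ t, ∑ j ∈ Finset.range i, k j ≤ t → t < ∑ j ∈ Finset.range (i + 1), k j →
      x t = ralt a i)
    (hxm : x (∑ j ∈ Finset.range m, k j) = ralt a m) :
    ∀ i < m, rle x i = (ralt a i, k i) := by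
  intro i hi
  have h := runStart_eq_of x a k m hk hx hxm
  rw [rle, h i hi.le, h (i + 1) hi]
  have hs : ∑ j ∈ Finset.range (i + 1), k j = ∑ j ∈ Finset.range i, k j + k i :=
      Finset.sum_range_succ _ _
  have := hk i hi
  rw [hx i hi _ le_rfl (by omega), hs]
  simp

/-- the word associated with runs -/
noncomputable def rdec (a : Bool) (k : ℕ → ℕ) (m t : ℕ) : Bool :=
  ralt a (((Finset.range m).filter fun i => ∑ j ∈ Finset.range (i + 1), k j ≤ t).card)

theorem rsum_mono (k : ℕ → ℕ) {i j : ℕ} (h : i ≤ j) :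
    ∑ l ∈ Finset.range i, k l ≤ ∑ l ∈ Finset.range j, k l :=
  Finset.sum_le_sum_of_subset (Finset.range_mono h)

theorem rdec_run (a : Bool) (k : ℕ → ℕ) (m i t : ℕ) (hi : i < m)
    (h1 : ∑ j ∈ Finset.range i, k j ≤ t) (h2 : t < ∑ j ∈ Finset.range (i + 1), k j) :
    rdec a k m t = ralt a i := by
  have : ((Finset.range m).filter fun i => ∑ j ∈ Finset.range (i + 1), k j ≤ t)
      = Finset.range i := by
    ext l
    simp only [Finset.mem_filter, Finset.mem_range]
    constructor
    · rintro ⟨_, h⟩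
      by_contra hc
      have := rsum_mono k (show i + 1 ≤ l + 1 by omega)
      omega
    · intro hl
      have := rsum_mono k (show l + 1 ≤ i by omega)
      exact ⟨by omega, by omega⟩
  rw [rdec, this, Finset.card_range]

theorem rdec_end (a : Bool) (k : ℕ → ℕ) (m : ℕ) :
    rdec a k m (∑ j ∈ Finset.range m, k j) = ralt a m := by
  rw [rdec, Finset.filter_true_of_mem, Finset.card_range]
  intro l hl
  exact rsum_mono k (Finset.mem_range.1 hl)

theorem rprod_word (r : Bool → ℝ) (a : Bool) (d : ℕ → Bool) (k : ℕ → ℕ) (m : ℕ)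
    (hk : ∀ i < m, 1 ≤ k i)
    (hx : ∀ i < m, ∀ t, ∑ j ∈ Finset.range i, k j ≤ t → t < ∑ j ∈ Finset.range (i + 1), k j →
      d t = ralt a i)
    (hxm : d (∑ j ∈ Finset.range m, k j) = ralt a m) :
    ∏ t ∈ Finset.range (∑ j ∈ Finset.range m, k j),
      (if d t = d (t + 1) then r (d t) else 1 - r (d t)) =
    ∏ i ∈ Finset.range m, (r (ralt a i) ^ (k i - 1) * (1 - r (ralt a i))) := by
  induction m with
  | zero => simp
  | succ m ih =>
    have hkm := hk m (by omega)
    have hs : ∑ j ∈ Finset.range (m + 1), k j = ∑ j ∈ Finset.range m, k j + ((k m - 1) + 1) := by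
      rw [Finset.sum_range_succ]; omega
    have hm : d (∑ j ∈ Finset.range m, k j) = ralt a m := hx m (by omega) _ le_rfl (by omega)
    rw [hs] at hxm
    rw [hs, Finset.prod_range_add, ih (fun i hi => hk i (by omega))
      (fun i hi => hx i (by omega)) hm, Finset.prod_range_succ _ m, Finset.prod_range_succ]
    congr 1
    have e1 : ∀ t < k m, d (∑ j ∈ Finset.range m, k j + t) = ralt a m := fun t ht =>
      hx m (by omega) _ (by omega) (by omega)
    congr 1
    · rw [← Finset.card_range (k m - 1), ← Finset.prod_const, Finset.card_range]
      refine Finset.prod_congr rfl fun t ht => ?_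
      have ht := Finset.mem_range.1 ht
      rw [add_assoc, e1 t (by omega), e1 (t + 1) (by omega)]
      simp
    · rw [add_assoc, e1 _ (by omega), hxm]
      simp [ralt]


noncomputable def GM (r : Bool → ℝ) (a : Bool) : Measure (Bool × ℕ) :=
  Measure.sum fun k : ℕ => ENNReal.ofReal (r a ^ k * (1 - r a)) • Measure.dirac (a, k + 1)

theorem GM_singleton_succ (r : Bool → ℝ) (a : Bool) (k : ℕ) :
    GM r a {(a, k + 1)} = ENNReal.ofReal (r a ^ k * (1 - r a)) := by
  rw [GM, Measure.sum_apply _ (MeasurableSet.singleton _), tsum_eq_single k]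
  · simp
  · intro j hj
    simp [hj]

theorem GM_singleton_ne (r : Bool → ℝ) (a : Bool) (w : Bool × ℕ)
    (hw : GM r a {w} ≠ 0) : w.1 = a ∧ 1 ≤ w.2 := by
  by_contra hc
  apply hw
  rw [GM, Measure.sum_apply _ (MeasurableSet.singleton _)]
  refine ENNReal.tsum_eq_zero.2 fun k => ?_
  have : (a, k + 1) ≠ w := by
    rintro rfl
    exact hc ⟨rfl, by simp⟩
  simp [this]

theorem rgeom (t : ℝ) (h0 : 0 < t) (h1 : t < 1) :
    ∑' k : ℕ, ENNReal.ofReal (t ^ k) = ENNReal.ofReal (1 - t)⁻¹ := by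
  rw [← ENNReal.ofReal_tsum_of_nonneg (fun k => by positivity)
    (summable_geometric_of_lt_one h0.le h1), tsum_geometric_of_lt_one h0.le h1]

theorem GM_prob (r : Bool → ℝ) (a : Bool) (h0 : 0 < r a) (h1 : r a < 1) :
    IsProbabilityMeasure (GM r a) := by
  constructor
  rw [GM, Measure.sum_apply _ MeasurableSet.univ]
  simp only [Measure.smul_apply, measure_univ, smul_eq_mul, mul_one]
  simp_rw [ENNReal.ofReal_mul (pow_nonneg h0.le _)]
  rw [ENNReal.tsum_mul_right, rgeom _ h0 h1, ← ENNReal.ofReal_mul (by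
    rw [inv_nonneg]; linarith), inv_mul_cancel₀ (by linarith)]
  simp

theorem GM_sq (r : Bool → ℝ) (a : Bool) (h0 : 0 < r a) (h1 : r a < 1) :
    ∑' w, GM r a {w} ^ 2 = ENNReal.ofReal ((1 - r a) / (1 + r a)) := by
  have hinj : Function.Injective (fun k : ℕ => (a, k + 1)) := by
    intro i j h
    simpa using h
  rw [← hinj.tsum_eq]
  · simp_rw [GM_singleton_succ]
    have : ∀ k : ℕ, ENNReal.ofReal (r a ^ k * (1 - r a)) ^ 2 =
        ENNReal.ofReal ((r a ^ 2) ^ k) * ENNReal.ofReal ((1 - r a) ^ 2) := by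
      intro k
      rw [← ENNReal.ofReal_pow (mul_nonneg (pow_nonneg h0.le _) (by linarith)),
        ← ENNReal.ofReal_mul (by positivity)]
      congr 1
      ring
    simp_rw [this]
    rw [ENNReal.tsum_mul_right, rgeom _ (by positivity) (by nlinarith),
      ← ENNReal.ofReal_mul (by rw [inv_nonneg]; nlinarith)]
    congr 1
    have e1 : 1 - r a ≠ 0 := by linarith
    have e2 : 1 + r a ≠ 0 := by linarith
    have : 1 - r a ^ 2 = (1 - r a) * (1 + r a) := by ring
    rw [this]
    field_simp
  · intro w hw
    have hw' : GM r a {w} ≠ 0 := by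
      intro h
      simp [h] at hw
    obtain ⟨e1, e2⟩ := GM_singleton_ne r a w hw'
    refine ⟨w.2 - 1, ?_⟩
    ext
    · exact e1.symm
    · simp; omega

theorem nextChange_spec {A : Type*} (x : ℕ → A) (i : ℕ) (h : ∃ j, x (i + j + 1) ≠ x i) :
    ∃ d, nextChange x i = i + d + 1 ∧ x (i + d + 1) ≠ x i ∧ ∀ e < d, x (i + e + 1) = x i := by
  classical
  rw [nextChange, dif_pos h]
  exact ⟨_, rfl, @Nat.find_spec _ _ h, fun e he => not_not.1 (@Nat.find_min _ _ h e he)⟩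

theorem measurable_nextChange (i : ℕ) : Measurable fun x : ℕ → Bool => nextChange x i := by
  have hc : ∀ j, MeasurableSet {x : ℕ → Bool | x (i + j + 1) = x i} := fun j =>
    measurableSet_eq_fun (measurable_pi_apply _) (measurable_pi_apply _)
  refine measurable_to_countable' fun y => ?_
  have : (fun x : ℕ → Bool => nextChange x i) ⁻¹' {y} =
      ({x | y = i + 1} ∩ ⋂ j, {x : ℕ → Bool | x (i + j + 1) = x i}) ∪
      ⋃ d, ({x | y = i + d + 1} ∩ {x : ℕ → Bool | x (i + d + 1) = x i}ᶜ ∩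
        ⋂ e, ⋂ (_ : e < d), {x : ℕ → Bool | x (i + e + 1) = x i}) := by
    ext x
    simp only [Set.mem_preimage, Set.mem_singleton_iff, Set.mem_union, Set.mem_inter_iff,
      Set.mem_iInter, Set.mem_iUnion, Set.mem_ofPred_eq, Set.mem_compl_iff]
    by_cases h : ∃ j, x (i + j + 1) ≠ x i
    · have hn : ¬ ∀ j, x (i + j + 1) = x i := by push Not; exact h
      obtain ⟨d, e1, e2, e3⟩ := nextChange_spec x i h
      rw [e1]
      constructor
      · rintro rfl
        exact Or.inr ⟨_, ⟨rfl, e2⟩, e3⟩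
      · rintro (⟨_, h'⟩ | ⟨d', ⟨rfl, h1⟩, h2⟩)
        · exact absurd h' hn
        · rcases lt_trichotomy d d' with hd | hd | hd
          · exact absurd (h2 d hd) e2
          · rw [hd]
          · exact absurd (e3 d' hd) h1
    · rw [nextChange, dif_neg h]
      push Not at h
      constructor
      · rintro rfl
        exact Or.inl ⟨rfl, h⟩
      · rintro (⟨h', _⟩ | ⟨d, ⟨_, h1⟩, _⟩)
        · exact h'.symm
        · exact absurd (h d) h1
  rw [this]
  refine ((MeasurableSet.const _).inter (MeasurableSet.iInter hc)).union
    (MeasurableSet.iUnion fun d => ((MeasurableSet.const _).inter (hc d).compl).inter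
      (MeasurableSet.iInter fun e => MeasurableSet.iInter fun _ => hc e))

theorem measurable_runStart (n : ℕ) : Measurable fun x : ℕ → Bool => runStart x n := by
  induction n with
  | zero => exact measurable_const
  | succ n ih =>
    have : Measurable fun z : (ℕ → Bool) × ℕ => nextChange z.1 z.2 :=
      measurable_from_prod_countable_left fun i => measurable_nextChange i
    exact this.comp (measurable_id.prodMk ih)

theorem measurable_rle : Measurable fun x : ℕ → Bool => rle x := by
  rw [measurable_pi_iff]
  intro n
  have : Measurable fun z : (ℕ → Bool) × ℕ => z.1 z.2 :=
    measurable_from_prod_countable_left fun i => measurable_pi_apply i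
  exact (this.comp (measurable_id.prodMk (measurable_runStart n))).prodMk
    ((measurable_runStart (n + 1)).sub (measurable_runStart n))

theorem rword_le (r π : Bool → ℝ) (h1 : ∀ a, r a < 1) (h0 : ∀ a, 0 < r a) (hπ : ∀ a, 0 < π a)
    (μ : Measure (ℕ → Bool))
    (hμ : ∀ (n : ℕ) (d : ℕ → Bool), μ {x | ∀ t ≤ n, x t = d t} =
      ENNReal.ofReal (π (d 0) * ∏ t ∈ Finset.range n,
        (if d t = d (t + 1) then r (d t) else 1 - r (d t))))
    (a : Bool) (m : ℕ) (w : ℕ → Bool × ℕ) (hw : ∀ i < m + 1, GM r (ralt a i) {w i} ≠ 0) :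
    ENNReal.ofReal (π a) * ∏ i ∈ Finset.range (m + 1), GM r (ralt a i) {w i} ≤
      μ {x | ∀ i < m + 1, rle x i = w i} := by
  set k : ℕ → ℕ := fun i => (w i).2 with hkdef
  have hwk : ∀ i < m + 1, w i = (ralt a i, k i) := fun i hi =>
    Prod.ext (GM_singleton_ne r _ _ (hw i hi)).1 rfl
  have hk : ∀ i < m + 1, 1 ≤ k i := fun i hi => (GM_singleton_ne r _ _ (hw i hi)).2
  have hrun := fun i hi t => rdec_run a k (m + 1) i t hi
  have hend := rdec_end a k (m + 1)
  have hsum : ∀ i, ∑ j ∈ Finset.range (i + 1), k j = ∑ j ∈ Finset.range i, k j + k i :=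
    fun i => Finset.sum_range_succ _ _
  have hd0 : rdec a k (m + 1) 0 = a := by
    have := hk 0 (by omega)
    exact hrun 0 (by omega) 0 (by simp) (by simp; omega)
  have h := hμ (∑ j ∈ Finset.range (m + 1), k j) (rdec a k (m + 1))
  rw [rprod_word r a _ k (m + 1) hk hrun hend, hd0, ENNReal.ofReal_mul (hπ a).le,
    ENNReal.ofReal_prod_of_nonneg] at h
  · have e : ∏ i ∈ Finset.range (m + 1), GM r (ralt a i) {w i} =
        ∏ i ∈ Finset.range (m + 1), ENNReal.ofReal
          (r (ralt a i) ^ (k i - 1) * (1 - r (ralt a i))) := by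
      refine Finset.prod_congr rfl fun i hi => ?_
      have hi := Finset.mem_range.1 hi
      have := hk i hi
      rw [← GM_singleton_succ, Nat.sub_add_cancel this, ← hwk i hi]
    rw [e, ← h]
    refine measure_mono fun x hx => ?_
    simp only [Set.mem_ofPred_eq] at hx ⊢
    intro i hi
    rw [hwk i hi]
    refine rle_eq_of x a k (m + 1) hk (fun i hi t ht1 ht2 => ?_) ?_ i hi
    · have := rsum_mono k (show i + 1 ≤ m + 1 by omega)
      rw [hx t (by omega)]
      exact hrun i hi t ht1 ht2
    · rw [hx _ le_rfl, hend]
  · intro i _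
    exact mul_nonneg (pow_nonneg (h0 _).le _) (by linarith [h1 (ralt a i)])

noncomputable def QM (r : Bool → ℝ) (a : Bool) : Measure (ℕ → Bool × ℕ) :=
  Measure.infinitePi fun i => GM r (ralt a i)

noncomputable def NM (r π : Bool → ℝ) : Measure (ℕ → Bool × ℕ) :=
  ENNReal.ofReal (π true) • QM r true + ENNReal.ofReal (π false) • QM r false

theorem QM_prob (r : Bool → ℝ) (a : Bool) (h0 : ∀ a, 0 < r a) (h1 : ∀ a, r a < 1) :
    IsProbabilityMeasure (QM r a) := by
  have : ∀ i, IsProbabilityMeasure (GM r (ralt a i)) := fun i => GM_prob r _ (h0 _) (h1 _)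
  unfold QM
  infer_instance

theorem QM_cyl (r : Bool → ℝ) (a : Bool) (h0 : ∀ a, 0 < r a) (h1 : ∀ a, r a < 1)
    (s : Finset ℕ) (w : ℕ → Bool × ℕ) :
    QM r a {u | ∀ i ∈ s, u i = w i} = ∏ i ∈ s, GM r (ralt a i) {w i} := by
  have : ∀ i, IsProbabilityMeasure (GM r (ralt a i)) := fun i => GM_prob r _ (h0 _) (h1 _)
  have h := Measure.infinitePi_pi (fun i => GM r (ralt a i)) (s := s) (t := fun i => {w i})
    (fun i _ => MeasurableSet.singleton _)
  rw [← h, QM]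
  congr 1

theorem rlaw (r π : Bool → ℝ) (h0 : ∀ a, 0 < r a) (h1 : ∀ a, r a < 1) (hπ : ∀ a, 0 < π a)
    (hπ1 : π true + π false = 1)
    (μ : Measure (ℕ → Bool)) [IsProbabilityMeasure μ]
    (hμ : ∀ (n : ℕ) (d : ℕ → Bool), μ {x | ∀ t ≤ n, x t = d t} =
      ENNReal.ofReal (π (d 0) * ∏ t ∈ Finset.range n,
        (if d t = d (t + 1) then r (d t) else 1 - r (d t)))) :
    μ.map (fun x => rle x) = NM r π := by
  have hQ : ∀ a, IsProbabilityMeasure (QM r a) := fun a => QM_prob r a h0 h1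
  have hN : IsProbabilityMeasure (NM r π) := by
    constructor
    simp only [NM, Measure.add_apply, Measure.smul_apply, measure_univ, smul_eq_mul, mul_one]
    rw [← ENNReal.ofReal_add (hπ _).le (hπ _).le, hπ1]
    simp
  have hM : IsProbabilityMeasure (μ.map (fun x => rle x)) :=
    Measure.isProbabilityMeasure_map measurable_rle.aemeasurable
  have key : ∀ m, (NM r π).map (Finset.range (m + 1)).restrict =
      (μ.map (fun x => rle x)).map (Finset.range (m + 1)).restrict := by
    intro m
    have i1 : IsProbabilityMeasure ((NM r π).map
        ((Finset.range (m + 1)).restrict (π := fun _ => Bool × ℕ))) :=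
      Measure.isProbabilityMeasure_map (Finset.measurable_restrict _).aemeasurable
    have i2 : IsProbabilityMeasure ((μ.map (fun x => rle x)).map
        ((Finset.range (m + 1)).restrict (π := fun _ => Bool × ℕ))) :=
      Measure.isProbabilityMeasure_map (Finset.measurable_restrict _).aemeasurable
    apply Measure.eq_of_le_of_isProbabilityMeasure
    refine Measure.le_iff.2 fun s hs => ?_
    rw [← Measure.tsum_indicator_apply_singleton _ s hs,
      ← Measure.tsum_indicator_apply_singleton _ s hs]
    refine ENNReal.tsum_le_tsum fun v => Set.indicator_le_indicator ?_
    rw [Measure.map_apply (Finset.measurable_restrict _) (MeasurableSet.singleton _),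
      Measure.map_apply (Finset.measurable_restrict _) (MeasurableSet.singleton _),
      Measure.map_apply measurable_rle
        (Finset.measurable_restrict _ (MeasurableSet.singleton _))]
    obtain ⟨w, rfl⟩ : ∃ w : ℕ → Bool × ℕ, (Finset.range (m + 1)).restrict w = v :=
      ⟨fun i => if h : i ∈ Finset.range (m + 1) then v ⟨i, h⟩ else (true, 0), by
        ext1 i
        simp [Finset.restrict]⟩
    have e1 : (Finset.range (m + 1)).restrict (π := fun _ => Bool × ℕ) ⁻¹'
        {(Finset.range (m + 1)).restrict w} =
        {u : ℕ → Bool × ℕ | ∀ i ∈ Finset.range (m + 1), u i = w i} := by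
      ext u
      simp [funext_iff, Finset.restrict]
    rw [e1]
    simp only [NM, Measure.add_apply, Measure.smul_apply, smul_eq_mul, QM_cyl r _ h0 h1]
    have e2 : (fun x : ℕ → Bool => rle x) ⁻¹'
        {u : ℕ → Bool × ℕ | ∀ i ∈ Finset.range (m + 1), u i = w i} =
        {x | ∀ i < m + 1, rle x i = w i} := by
      ext x
      simp
    rw [e2]
    have hz : ∀ a, (¬ ∀ i < m + 1, GM r (ralt a i) {w i} ≠ 0) →
        ∏ i ∈ Finset.range (m + 1), GM r (ralt a i) {w i} = 0 := by
      intro a h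
      push Not at h
      obtain ⟨i, hi, h⟩ := h
      exact Finset.prod_eq_zero (Finset.mem_range.2 hi) h
    by_cases ht : ∀ i < m + 1, GM r (ralt true i) {w i} ≠ 0
    · have hf : ¬ ∀ i < m + 1, GM r (ralt false i) {w i} ≠ 0 := by
        intro hf
        have h1 := (GM_singleton_ne r _ _ (ht 0 (by omega))).1
        have h2 := (GM_singleton_ne r _ _ (hf 0 (by omega))).1
        rw [h1] at h2
        simp [ralt] at h2
      rw [hz false hf, mul_zero, add_zero]
      exact rword_le r π h1 h0 hπ μ hμ true m w ht
    · rw [hz true ht, mul_zero, zero_add]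
      by_cases hf : ∀ i < m + 1, GM r (ralt false i) {w i} ≠ 0
      · exact rword_le r π h1 h0 hπ μ hμ false m w hf
      · rw [hz false hf, mul_zero]
        exact zero_le
  have hlim : IsProjectiveLimit (μ.map (fun x => rle x))
      (fun I : Finset ℕ => (NM r π).map I.restrict) := by
    intro I
    obtain ⟨m, hm⟩ := I.exists_nat_subset_range
    have hsub : I ⊆ Finset.range (m + 1) := hm.trans (Finset.range_mono (by omega))
    have e : (I.restrict : (ℕ → Bool × ℕ) → _) =
        Finset.restrict₂ hsub ∘ (Finset.range (m + 1)).restrict := rfl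
    simp only
    rw [e, ← Measure.map_map (Finset.measurable_restrict₂ _) (Finset.measurable_restrict _),
      ← Measure.map_map (Finset.measurable_restrict₂ _) (Finset.measurable_restrict _), key m]
  have : ∀ I : Finset ℕ, IsFiniteMeasure ((NM r π).map
      (I.restrict (π := fun _ => Bool × ℕ))) := fun I => inferInstance
  exact IsProjectiveLimit.unique hlim (fun I => rfl)


theorem rsecmom {Ω ι : Type*} [MeasurableSpace Ω] (P : Measure Ω) [IsProbabilityMeasure P]
    (E : Finset ι) (A : ι → Set Ω) (hA : ∀ e ∈ E, MeasurableSet (A e)) (m V : ℝ) (hm : 0 < m)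
    (h1 : ∑ e ∈ E, P.real (A e) = m)
    (h2 : ∑ e ∈ E, ∑ e' ∈ E, P.real (A e ∩ A e') ≤ m ^ 2 + V) (B : Set Ω)
    (hB : MeasurableSet B) (hBA : ∀ e ∈ E, Disjoint B (A e)) :
    P.real B ≤ V / m ^ 2 := by
  classical
  have hi : ∀ S : Set Ω, MeasurableSet S → Integrable (S.indicator (1 : Ω → ℝ)) P := fun S hS =>
    (integrable_const (1 : ℝ)).indicator hS
  have hpt : ∀ ω, m ^ 2 * B.indicator (1 : Ω → ℝ) ω ≤
      (∑ e ∈ E, ∑ e' ∈ E, (A e ∩ A e').indicator (1 : Ω → ℝ) ω) -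
        2 * m * (∑ e ∈ E, (A e).indicator (1 : Ω → ℝ) ω) + m ^ 2 := by
    intro ω
    have e1 : (∑ e ∈ E, ∑ e' ∈ E, (A e ∩ A e').indicator (1 : Ω → ℝ) ω) =
        (∑ e ∈ E, (A e).indicator (1 : Ω → ℝ) ω) ^ 2 := by
      rw [sq, Finset.sum_mul_sum]
      refine Finset.sum_congr rfl fun e _ => Finset.sum_congr rfl fun e' _ => ?_
      rw [Set.inter_indicator_one]
      rfl
    rw [e1]
    by_cases hω : ω ∈ B
    · have : ∑ e ∈ E, (A e).indicator (1 : Ω → ℝ) ω = 0 := by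
        refine Finset.sum_eq_zero fun e he => ?_
        exact Set.indicator_of_notMem (Set.disjoint_left.1 (hBA e he) hω) _
      rw [this]
      simp [hω]
    · rw [Set.indicator_of_notMem hω]
      nlinarith [sq_nonneg (∑ e ∈ E, (A e).indicator (1 : Ω → ℝ) ω - m)]
  have hI1 : Integrable (fun ω => ∑ e ∈ E, (A e).indicator (1 : Ω → ℝ) ω) P :=
    integrable_finsetSum _ fun e he => hi _ (hA e he)
  have hI2 : Integrable (fun ω => ∑ e ∈ E, ∑ e' ∈ E, (A e ∩ A e').indicator (1 : Ω → ℝ) ω) P :=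
    integrable_finsetSum _ fun e he => integrable_finsetSum _ fun e' he' =>
      hi _ ((hA e he).inter (hA e' he'))
  have hint := integral_mono ((hi B hB).const_mul (m ^ 2))
    ((hI2.sub (hI1.const_mul (2 * m))).add (integrable_const (m ^ 2))) hpt
  rw [integral_const_mul, integral_indicator_one hB] at hint
  simp only [Pi.add_apply, Pi.sub_apply] at hint
  have hs : Integrable (fun ω => (∑ e ∈ E, ∑ e' ∈ E, (A e ∩ A e').indicator (1 : Ω → ℝ) ω) -
        2 * m * (∑ e ∈ E, (A e).indicator (1 : Ω → ℝ) ω)) P := hI2.sub (hI1.const_mul (2 * m))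
  rw [integral_add hs (integrable_const _),
    integral_sub hI2 (hI1.const_mul (2 * m)), integral_const_mul,
    integral_finsetSum _ (fun e he => hi _ (hA e he)),
    integral_finsetSum _ (fun e he => integrable_finsetSum _ fun e' he' =>
      hi _ ((hA e he).inter (hA e' he')))] at hint
  have e3 : ∑ e ∈ E, ∫ ω, (A e).indicator (1 : Ω → ℝ) ω ∂P = m := by
    rw [← h1]
    exact Finset.sum_congr rfl fun e he => integral_indicator_one (hA e he)
  have e4 : ∑ e ∈ E, ∫ ω, ∑ e' ∈ E, (A e ∩ A e').indicator (1 : Ω → ℝ) ω ∂P =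
      ∑ e ∈ E, ∑ e' ∈ E, P.real (A e ∩ A e') := by
    refine Finset.sum_congr rfl fun e he => ?_
    rw [integral_finsetSum _ fun e' he' => hi _ ((hA e he).inter (hA e' he'))]
    exact Finset.sum_congr rfl fun e' he' => integral_indicator_one ((hA e he).inter (hA e' he'))
  rw [e3, e4] at hint
  simp only [integral_const, probReal_univ, one_smul] at hint
  rw [le_div_iff₀ (by positivity)]
  nlinarith

theorem rprod_eq {Ω₁ Ω₂ W : Type*} [MeasurableSpace Ω₁] [MeasurableSpace Ω₂] [MeasurableSpace W]
    [Countable W] [MeasurableSingletonClass W] (P₁ : Measure Ω₁) (P₂ : Measure Ω₂)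
    [SFinite P₁] [SFinite P₂]
    (X : Ω₁ → W) (Y : Ω₂ → W) (hX : Measurable X) (hY : Measurable Y) :
    (P₁.prod P₂) {z | X z.1 = Y z.2} = ∑' w, P₁ {x | X x = w} * P₂ {y | Y y = w} := by
  have : {z : Ω₁ × Ω₂ | X z.1 = Y z.2} = ⋃ w, {x | X x = w} ×ˢ {y | Y y = w} := by
    ext z
    simp [eq_comm]
  rw [this, measure_iUnion]
  · simp_rw [Measure.prod_prod]
  · intro w w' hne
    rw [Function.onFun, Set.disjoint_left]
    rintro z ⟨h1, _⟩ ⟨h2, _⟩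
    exact hne (h1.symm.trans h2)
  · intro w
    exact (hX (MeasurableSet.singleton w)).prod (hY (MeasurableSet.singleton w))

theorem rmatch {Ω₁ Ω₂ W : Type*} [MeasurableSpace Ω₁] [MeasurableSpace Ω₂] [MeasurableSpace W]
    [Countable W] [MeasurableSingletonClass W] (P₁ : Measure Ω₁) (P₂ : Measure Ω₂)
    [IsProbabilityMeasure P₁] [IsProbabilityMeasure P₂] (N : ℕ) (hN : 0 < N)
    (X : ℕ → Ω₁ → W) (Y : ℕ → Ω₂ → W) (hX : ∀ i, Measurable (X i)) (hY : ∀ i, Measurable (Y i))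
    (D : W → ENNReal) (t : ℝ) (ht : 0 < t) (hD : ∑' w, D w ^ 2 = ENNReal.ofReal (t ^ 2))
    (hX1 : ∀ i w, P₁ {x | X i x = w} = D w) (hY1 : ∀ i w, P₂ {x | Y i x = w} = D w)
    (hX2 : ∀ i i' w w', i ≠ i' → P₁ {x | X i x = w ∧ X i' x = w'} = D w * D w')
    (hY2 : ∀ i i' w w', i ≠ i' → P₂ {x | Y i x = w ∧ Y i' x = w'} = D w * D w') :
    (P₁.prod P₂) {z | ∀ i < N, ∀ j < N, X i z.1 ≠ Y j z.2} ≤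
      ENNReal.ofReal (2 / (N * t) + 1 / (N * t) ^ 2) := by
  classical
  set P := P₁.prod P₂
  have hDt : ∀ w, D w ≤ ENNReal.ofReal t := by
    intro w
    have : D w ^ 2 ≤ ENNReal.ofReal t ^ 2 := by
      rw [← ENNReal.ofReal_pow ht.le, ← hD]
      exact ENNReal.le_tsum w
    exact (ENNReal.pow_le_pow_left_iff (by norm_num)).1 this
  set A : ℕ × ℕ → Set (Ω₁ × Ω₂) := fun e => {z | X e.1 z.1 = Y e.2 z.2}
  have hA : ∀ e, MeasurableSet (A e) := fun e =>
    measurableSet_eq_fun ((hX _).comp measurable_fst) ((hY _).comp measurable_snd)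
  have hPA : ∀ e, P (A e) = ENNReal.ofReal (t ^ 2) := by
    intro e
    rw [rprod_eq P₁ P₂ _ _ (hX e.1) (hY e.2), ← hD]
    simp_rw [hX1, hY1, sq]
  have hcube : ∑' w, D w * (D w * D w) ≤ ENNReal.ofReal (t ^ 3) := by
    calc ∑' w, D w * (D w * D w) ≤ ∑' w, ENNReal.ofReal t * D w ^ 2 := by
          refine ENNReal.tsum_le_tsum fun w => ?_
          rw [sq]
          gcongr
          exact hDt w
      _ = ENNReal.ofReal (t ^ 3) := by
          rw [ENNReal.tsum_mul_left, hD, ← ENNReal.ofReal_mul ht.le]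
          congr 1; ring
  have hpair : ∀ e e', P.real (A e ∩ A e') ≤ t ^ 4 + (if e.1 = e'.1 then t ^ 3 else 0) +
      (if e.2 = e'.2 then t ^ 3 else 0) + (if e = e' then t ^ 2 else 0) := by
    rintro ⟨i, j⟩ ⟨i', j'⟩
    by_cases h1 : i = i'
    · subst h1
      by_cases h2 : j = j'
      · subst h2
        have : P.real (A (i, j) ∩ A (i, j)) = t ^ 2 := by
          rw [Set.inter_self, Measure.real, hPA, ENNReal.toReal_ofReal (by positivity)]
        rw [this]
        simp
        positivity
      · have hle : P (A (i, j) ∩ A (i, j')) ≤ ENNReal.ofReal (t ^ 3) := by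
          refine le_trans ?_ hcube
          have hsub : A (i, j) ∩ A (i, j') ⊆
              ⋃ w, {x | X i x = w} ×ˢ {y | Y j y = w ∧ Y j' y = w} := by
            rintro z ⟨h3, h4⟩
            exact Set.mem_iUnion.2 ⟨X i z.1, rfl, h3.symm, h4.symm⟩
          refine (measure_mono hsub).trans ((measure_iUnion_le _).trans ?_)
          simp_rw [P, Measure.prod_prod, hX1, hY2 j j' _ _ h2]
          exact le_rfl
        have := ENNReal.toReal_le_of_le_ofReal (by positivity) hle
        simp only [h2, if_true, if_false, Prod.mk.injEq, and_false]
        refine le_trans this ?_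
        have : 0 < t ^ 4 := by positivity
        linarith
    · by_cases h2 : j = j'
      · subst h2
        have hle : P (A (i, j) ∩ A (i', j)) ≤ ENNReal.ofReal (t ^ 3) := by
          refine le_trans ?_ hcube
          have hsub : A (i, j) ∩ A (i', j) ⊆
              ⋃ w, {x | X i x = w ∧ X i' x = w} ×ˢ {y | Y j y = w} := by
            rintro z ⟨h3, h4⟩
            exact Set.mem_iUnion.2 ⟨Y j z.2, ⟨h3, h4⟩, rfl⟩
          refine (measure_mono hsub).trans ((measure_iUnion_le _).trans ?_)
          simp_rw [P, Measure.prod_prod, hY1, hX2 i i' _ _ h1, mul_assoc]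
          exact le_rfl
        have := ENNReal.toReal_le_of_le_ofReal (by positivity) hle
        simp only [h1, if_true, if_false, Prod.mk.injEq, false_and]
        refine le_trans this ?_
        have : 0 < t ^ 4 := by positivity
        linarith
      · have hle : P (A (i, j) ∩ A (i', j')) ≤ ENNReal.ofReal (t ^ 4) := by
          have hsub : A (i, j) ∩ A (i', j') ⊆
              ⋃ w : W × W, {x | X i x = w.1 ∧ X i' x = w.2} ×ˢ
                {y | Y j y = w.1 ∧ Y j' y = w.2} := by
            rintro z ⟨h3, h4⟩
            exact Set.mem_iUnion.2 ⟨(Y j z.2, Y j' z.2), ⟨h3, h4⟩, rfl, rfl⟩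
          refine (measure_mono hsub).trans ((measure_iUnion_le _).trans ?_)
          simp_rw [P, Measure.prod_prod, hY2 j j' _ _ h2, hX2 i i' _ _ h1]
          rw [ENNReal.tsum_prod (f := fun a b => D a * D b * (D a * D b))]
          have : ∀ a b, D a * D b * (D a * D b) = D a ^ 2 * D b ^ 2 := fun a b => by ring
          simp_rw [this, ENNReal.tsum_mul_left, ENNReal.tsum_mul_right, hD]
          rw [← ENNReal.ofReal_mul (by positivity)]
          apply le_of_eq
          congr 1; ring
        have := ENNReal.toReal_le_of_le_ofReal (by positivity) hle
        simp only [h1, h2, if_false, Prod.mk.injEq, false_and, add_zero]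
        exact this
  have hNr : (0 : ℝ) < N := by exact_mod_cast hN
  have hfin := rsecmom P (Finset.range N ×ˢ Finset.range N) A (fun e _ => hA e)
    (N ^ 2 * t ^ 2) (2 * N ^ 3 * t ^ 3 + N ^ 2 * t ^ 2) (by positivity) ?_ ?_
    {z | ∀ i < N, ∀ j < N, X i z.1 ≠ Y j z.2} ?_ ?_
  · have e : (2 * N ^ 3 * t ^ 3 + N ^ 2 * t ^ 2) / ((N:ℝ) ^ 2 * t ^ 2) ^ 2 =
        2 / (N * t) + 1 / (N * t) ^ 2 := by
      field_simp
    rw [e, Measure.real] at hfin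
    exact (ENNReal.le_ofReal_iff_toReal_le (measure_ne_top _ _) (by positivity)).2 hfin
  · have : ∀ e, P.real (A e) = t ^ 2 := fun e => by
      rw [Measure.real, hPA, ENNReal.toReal_ofReal (by positivity)]
    simp only [this, Finset.sum_const, Finset.card_product, Finset.card_range, nsmul_eq_mul,
      Nat.cast_mul]
    ring
  · refine (Finset.sum_le_sum fun e _ => Finset.sum_le_sum fun e' _ => hpair e e').trans ?_
    apply le_of_eq
    have hin : ∀ e ∈ Finset.range N ×ˢ Finset.range N,
        ∑ e' ∈ Finset.range N ×ˢ Finset.range N,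
        (t ^ 4 + (if e.1 = e'.1 then t ^ 3 else 0) +
      (if e.2 = e'.2 then t ^ 3 else 0) + (if e = e' then t ^ 2 else 0)) =
        N ^ 2 * t ^ 4 + N * t ^ 3 + N * t ^ 3 + t ^ 2 := by
      intro e he
      have he1 := (Finset.mem_product.1 he).1
      have he2 := (Finset.mem_product.1 he).2
      rw [Finset.sum_add_distrib, Finset.sum_add_distrib, Finset.sum_add_distrib,
        Finset.sum_ite_eq, if_pos he]
      congr 1
      congr 1
      · congr 1
        · simp only [Finset.sum_const, Finset.card_product, Finset.card_range, nsmul_eq_mul,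
            Nat.cast_mul]
          ring
        · rw [Finset.sum_product_right]
          simp only [Finset.sum_ite_eq, if_pos he1]
          simp
      · rw [Finset.sum_product]
        simp only [Finset.sum_ite_eq, if_pos he2]
        simp
    rw [Finset.sum_congr rfl hin]
    simp only [Finset.sum_const, Finset.card_product, Finset.card_range, nsmul_eq_mul,
      Nat.cast_mul]
    ring
  · have : {z : Ω₁ × Ω₂ | ∀ i < N, ∀ j < N, X i z.1 ≠ Y j z.2} =
        ⋂ i, ⋂ (_ : i < N), ⋂ j, ⋂ (_ : j < N), (A (i, j))ᶜ := by
      ext z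
      simp [A]
    rw [this]
    exact MeasurableSet.iInter fun i => MeasurableSet.iInter fun _ =>
      MeasurableSet.iInter fun j => MeasurableSet.iInter fun _ => (hA _).compl
  · intro e he
    rw [Set.disjoint_left]
    intro z hz hz'
    exact hz e.1 (Finset.mem_range.1 (Finset.mem_product.1 he).1) e.2
      (Finset.mem_range.1 (Finset.mem_product.1 he).2) hz'

theorem rtsum_pi {W : Type*} (n : ℕ) (f : Fin n → W → ENNReal) :
    ∑' w : Fin n → W, ∏ i, f i (w i) = ∏ i, ∑' v, f i v := by
  induction n with
  | zero => simp [tsum_fintype]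
  | succ n ih =>
    rw [Fin.prod_univ_succ, ← ih, ← (Fin.consEquiv fun _ => W).tsum_eq]
    simp only [Fin.consEquiv, Equiv.coe_fn_mk, Fin.prod_univ_succ, Fin.cons_zero, Fin.cons_succ]
    rw [ENNReal.tsum_prod (f := fun a (b : Fin n → W) => f 0 a * ∏ i : Fin n, f i.succ (b i))]
    simp_rw [ENNReal.tsum_mul_left, ENNReal.tsum_mul_right]

theorem rprod_ralt (s : Bool → ENNReal) (a : Bool) (L : ℕ) :
    ∏ m : Fin (2 * L), s (ralt a m) = (s true * s false) ^ L := by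
  rw [Fin.prod_univ_eq_prod_range (fun m => s (ralt a m))]
  induction L with
  | zero => simp
  | succ L ih =>
    rw [show 2 * (L + 1) = 2 * L + 1 + 1 by ring, Finset.prod_range_succ, Finset.prod_range_succ,
      ih, pow_succ, mul_assoc]
    congr 1
    rw [ralt, ralt_two_mul]
    cases a <;> simp [mul_comm]

/-- law of a block of runs starting with letter `a` -/
noncomputable def BD (r : Bool → ℝ) (a : Bool) (K : ℕ) (w : Fin K → Bool × ℕ) : ENNReal :=
  ∏ m : Fin K, GM r (ralt a m) {w m}

theorem BD_sq (r : Bool → ℝ) (a : Bool) (h0 : ∀ a, 0 < r a) (h1 : ∀ a, r a < 1) (L : ℕ) :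
    ∑' w, BD r a (2 * L) w ^ 2 = ENNReal.ofReal
      (((1 - r true) * (1 - r false) / ((1 + r true) * (1 + r false))) ^ L) := by
  simp_rw [BD, ← Finset.prod_pow]
  rw [rtsum_pi _ (fun (m : Fin (2 * L)) v => GM r (ralt a m) {v} ^ 2)]
  simp_rw [GM_sq r _ (h0 _) (h1 _)]
  rw [rprod_ralt (fun b => ENNReal.ofReal ((1 - r b) / (1 + r b))),
    ← ENNReal.ofReal_mul, ← ENNReal.ofReal_pow]
  · congr 2
    rw [div_mul_div_comm]
  · exact mul_nonneg (div_nonneg (by linarith [h1 true]) (by linarith [h0 true]))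
      (div_nonneg (by linarith [h1 false]) (by linarith [h0 false]))
  · exact (div_nonneg (by linarith [h1 true]) (by linarith [h0 true]))

theorem QM_inj (r : Bool → ℝ) (a : Bool) (h0 : ∀ a, 0 < r a) (h1 : ∀ a, r a < 1)
    {ι : Type*} [Fintype ι] (φ : ι → ℕ) (hφ : Function.Injective φ) (v : ι → Bool × ℕ) :
    QM r a {u | ∀ l, u (φ l) = v l} = ∏ l, GM r (ralt a (φ l)) {v l} := by
  have h := QM_cyl r a h0 h1 (Finset.univ.map ⟨φ, hφ⟩) (Function.extend φ v fun _ => (true, 0))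
  rw [Finset.prod_map] at h
  simp only [Function.Embedding.coeFn_mk, hφ.extend_apply] at h
  rw [← h]
  congr 1
  ext u
  simp [hφ.extend_apply]

theorem QM_block (r : Bool → ℝ) (a : Bool) (h0 : ∀ a, 0 < r a) (h1 : ∀ a, r a < 1)
    (c K : ℕ) (w : Fin K → Bool × ℕ) :
    QM r a {u | (fun m : Fin K => u (c + m)) = w} = BD r (ralt a c) K w := by
  have h := QM_inj r a h0 h1 (fun m : Fin K => c + (m : ℕ)) (by
    intro i j hij
    simp at hij
    exact Fin.ext hij) w
  rw [BD]
  simp_rw [← ralt_add]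
  rw [← h]
  simp only [funext_iff]

theorem QM_block2 (r : Bool → ℝ) (a : Bool) (h0 : ∀ a, 0 < r a) (h1 : ∀ a, r a < 1)
    (c c' K : ℕ) (hc : c + K ≤ c' ∨ c' + K ≤ c) (w w' : Fin K → Bool × ℕ) :
    QM r a {u | (fun m : Fin K => u (c + m)) = w ∧ (fun m : Fin K => u (c' + m)) = w'} =
      BD r (ralt a c) K w * BD r (ralt a c') K w' := by
  have h := QM_inj r a h0 h1
    (Sum.elim (fun m : Fin K => c + (m : ℕ)) (fun m : Fin K => c' + (m : ℕ))) (by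
    rintro (i | i) (j | j) hij <;> simp at hij
    · exact congrArg _ (Fin.ext hij)
    · have := i.2; have := j.2; omega
    · have := i.2; have := j.2; omega
    · exact congrArg _ (Fin.ext hij)) (Sum.elim w w')
  rw [Fintype.prod_sum_type] at h
  simp only [Sum.elim_inl, Sum.elim_inr, Sum.forall] at h
  rw [BD, BD]
  simp_rw [← ralt_add]
  rw [← h]
  simp only [funext_iff]


/-- matching event -/
def ME (n k : ℕ) : Set ((ℕ → Bool × ℕ) × (ℕ → Bool × ℕ)) :=
  {z | ∃ i j, i + k ≤ n ∧ j + k ≤ n ∧ ∀ m < k, z.1 (i + m) = z.2 (j + m)}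

theorem le_matchLen_iff {C : Type*} (u v : ℕ → C) (n k : ℕ) :
    k ≤ matchLen u v n ↔ ∃ i j, i + k ≤ n ∧ j + k ≤ n ∧ ∀ m < k, u (i + m) = v (j + m) := by
  have hb : BddAbove {k | ∃ i j, i + k ≤ n ∧ j + k ≤ n ∧ ∀ m < k, u (i + m) = v (j + m)} :=
    ⟨n, by rintro k ⟨i, j, h1, _⟩; omega⟩
  have hne : {k | ∃ i j, i + k ≤ n ∧ j + k ≤ n ∧ ∀ m < k, u (i + m) = v (j + m)}.Nonempty :=
    ⟨0, 0, 0, by simp⟩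
  constructor
  · intro h
    obtain ⟨i, j, h1, h2, h3⟩ := Nat.sSup_mem hne hb
    change i + matchLen u v n ≤ n at h1
    change j + matchLen u v n ≤ n at h2
    change ∀ m < matchLen u v n, _ at h3
    exact ⟨i, j, by omega, by omega, fun m hm => h3 m (by omega)⟩
  · intro h
    exact le_csSup hb h

theorem matchLen_le {C : Type*} (u v : ℕ → C) (n : ℕ) : matchLen u v n ≤ n := by
  refine csSup_le' ?_
  rintro k ⟨i, j, h1, _⟩
  omega

theorem matchLen_mono {C : Type*} (u v : ℕ → C) {n n' : ℕ} (h : n ≤ n') :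
    matchLen u v n ≤ matchLen u v n' := by
  obtain ⟨i, j, h2, h3, h4⟩ := (le_matchLen_iff u v n _).1 le_rfl
  exact (le_matchLen_iff u v n' _).2 ⟨i, j, by omega, by omega, h4⟩

theorem rprob_up (r π : Bool → ℝ) (h0 : ∀ a, 0 < r a) (h1 : ∀ a, r a < 1) (hπ : ∀ a, 0 < π a)
    (hπ1 : π true + π false = 1) (n L : ℕ) :
    ((NM r π).prod (NM r π)) (ME n (2 * L)) ≤ ENNReal.ofReal (8 * (n + 1) ^ 2 *
      ((1 - r true) * (1 - r false) / ((1 + r true) * (1 + r false))) ^ L) := by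
  have hQ : ∀ a, IsProbabilityMeasure (QM r a) := fun a => QM_prob r a h0 h1
  have hSF : SFinite (NM r π) := by unfold NM; infer_instance
  set σ := (1 - r true) * (1 - r false) / ((1 + r true) * (1 + r false)) with hσ
  have hσ0 : 0 ≤ σ := div_nonneg (mul_nonneg (by linarith [h1 true]) (by linarith [h1 false]))
    (mul_nonneg (by linarith [h0 true]) (by linarith [h0 false]))
  have hmeas : ∀ c, Measurable fun (u : ℕ → Bool × ℕ) (m : Fin (2 * L)) => u (c + m) := fun c =>
    measurable_pi_iff.2 fun m => measurable_pi_apply _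
  have hN : ∀ c (w : Fin (2 * L) → Bool × ℕ), NM r π {u | (fun m : Fin (2 * L) => u (c + m)) = w} ≤
      BD r true (2 * L) w + BD r false (2 * L) w := by
    intro c w
    have hb : ∀ b, BD r b (2 * L) w ≤ BD r true (2 * L) w + BD r false (2 * L) w := by
      intro b
      cases b
      · exact le_add_self
      · exact le_self_add
    simp only [NM, Measure.add_apply, Measure.smul_apply, smul_eq_mul, QM_block r _ h0 h1]
    calc _ ≤ ENNReal.ofReal (π true) * (BD r true (2 * L) w + BD r false (2 * L) w) +
        ENNReal.ofReal (π false) * (BD r true (2 * L) w + BD r false (2 * L) w) := by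
          gcongr
          · exact hb _
          · exact hb _
      _ = _ := by
        rw [← add_mul, ← ENNReal.ofReal_add (hπ _).le (hπ _).le, hπ1]
        simp
  have hpair : ∀ i j, ((NM r π).prod (NM r π))
      {z | (fun m : Fin (2 * L) => z.1 (i + m)) = (fun m : Fin (2 * L) => z.2 (j + m))} ≤
      ENNReal.ofReal (8 * σ ^ L) := by
    intro i j
    rw [rprod_eq _ _ _ _ (hmeas i) (hmeas j)]
    calc _ ≤ ∑' w, (4 * (BD r true (2 * L) w ^ 2) + 4 * (BD r false (2 * L) w ^ 2)) := by
          refine ENNReal.tsum_le_tsum fun w => ?_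
          refine (mul_le_mul' (hN i w) (hN j w)).trans ?_
          generalize BD r true (2 * L) w = x
          generalize BD r false (2 * L) w = y
          rcases le_total x y with h | h
          · calc (x + y) * (x + y) ≤ (y + y) * (y + y) := by gcongr
              _ = 4 * y ^ 2 := by ring
              _ ≤ _ := le_add_self
          · calc (x + y) * (x + y) ≤ (x + x) * (x + x) := by gcongr
              _ = 4 * x ^ 2 := by ring
              _ ≤ _ := le_self_add
      _ = ENNReal.ofReal (8 * σ ^ L) := by
          rw [ENNReal.tsum_add, ENNReal.tsum_mul_left, ENNReal.tsum_mul_left,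
            BD_sq r _ h0 h1, BD_sq r _ h0 h1, ← add_mul, ENNReal.ofReal_mul (by norm_num)]
          congr 1
          norm_num
  have hsub : ME n (2 * L) ⊆ ⋃ e ∈ Finset.range (n + 1) ×ˢ Finset.range (n + 1),
      {z | (fun m : Fin (2 * L) => z.1 (e.1 + m)) = (fun m : Fin (2 * L) => z.2 (e.2 + m))} := by
    rintro z ⟨i, j, hi, hj, h⟩
    refine Set.mem_biUnion (x := (i, j)) ?_ ?_
    · simp
      omega
    · funext m
      exact h m m.2
  refine (measure_mono hsub).trans ((measure_biUnion_finset_le _ _).trans ?_)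
  refine (Finset.sum_le_sum fun e _ => hpair e.1 e.2).trans ?_
  simp only [Finset.sum_const, Finset.card_product, Finset.card_range, nsmul_eq_mul]
  rw [← ENNReal.ofReal_natCast, ← ENNReal.ofReal_mul (by positivity)]
  apply ENNReal.ofReal_le_ofReal
  apply le_of_eq
  push_cast
  ring

theorem rprob_low (r π : Bool → ℝ) (h0 : ∀ a, 0 < r a) (h1 : ∀ a, r a < 1) (hπ : ∀ a, 0 < π a)
    (hπ1 : π true + π false = 1) (n L N : ℕ) (hNpos : 0 < N) (hn : 2 * L * N + 1 ≤ n) :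
    ((NM r π).prod (NM r π)) (ME n (2 * L))ᶜ ≤ ENNReal.ofReal
      (2 / (N * √(((1 - r true) * (1 - r false) / ((1 + r true) * (1 + r false))) ^ L)) +
       1 / (N * √(((1 - r true) * (1 - r false) / ((1 + r true) * (1 + r false))) ^ L)) ^ 2) := by
  have hQ : ∀ a, IsProbabilityMeasure (QM r a) := fun a => QM_prob r a h0 h1
  set σ := (1 - r true) * (1 - r false) / ((1 + r true) * (1 + r false)) with hσ
  have hσ0 : 0 < σ := div_pos (mul_pos (by linarith [h1 true]) (by linarith [h1 false]))
    (mul_pos (by linarith [h0 true]) (by linarith [h0 false]))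
  set B := ENNReal.ofReal (2 / (N * √(σ ^ L)) + 1 / (N * √(σ ^ L)) ^ 2) with hB
  have hmeas : ∀ c, Measurable fun (u : ℕ → Bool × ℕ) (m : Fin (2 * L)) => u (c + m) := fun c =>
    measurable_pi_iff.2 fun m => measurable_pi_apply _
  have key : ∀ a b, ((QM r a).prod (QM r b)) (ME n (2 * L))ᶜ ≤ B := by
    intro a b
    obtain ⟨o, ho, hob⟩ : ∃ o ≤ 1, ralt b o = a := by
      by_cases h : a = b
      · exact ⟨0, by omega, h.symm⟩
      · refine ⟨1, le_rfl, ?_⟩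
        cases a <;> cases b <;> simp_all [ralt]
    have hai : ∀ i, ralt a (2 * L * i) = a := fun i => by rw [mul_assoc, ralt_two_mul]
    have hbi : ∀ i, ralt b (2 * L * i + o) = a := fun i => by
      rw [mul_assoc, ralt_add, ralt_two_mul, hob]
    have hsep : ∀ i i' : ℕ, i ≠ i' → 2 * L * i + 2 * L ≤ 2 * L * i' ∨
        2 * L * i' + 2 * L ≤ 2 * L * i := by
      intro i i' h
      rcases Nat.lt_or_gt_of_ne h with h | h
      · left
        calc 2 * L * i + 2 * L = 2 * L * (i + 1) := by ring
          _ ≤ _ := Nat.mul_le_mul_left _ h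
      · right
        calc 2 * L * i' + 2 * L = 2 * L * (i' + 1) := by ring
          _ ≤ _ := Nat.mul_le_mul_left _ h
    have h := rmatch (QM r a) (QM r b) N hNpos
      (fun i (u : ℕ → Bool × ℕ) (m : Fin (2 * L)) => u (2 * L * i + m))
      (fun i (u : ℕ → Bool × ℕ) (m : Fin (2 * L)) => u (2 * L * i + o + m))
      (fun i => hmeas _) (fun i => hmeas _) (BD r a (2 * L)) (√(σ ^ L)) (by positivity)
      (by rw [BD_sq r a h0 h1, Real.sq_sqrt (by positivity)])
      (fun i w => by rw [QM_block r a h0 h1, hai])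
      (fun i w => by rw [QM_block r b h0 h1, hbi])
      (fun i i' w w' hne => by rw [QM_block2 r a h0 h1 _ _ _ (hsep i i' hne), hai, hai])
      (fun i i' w w' hne => by
        rw [QM_block2 r b h0 h1 _ _ _ (by have := hsep i i' hne; omega), hbi, hbi])
    refine le_trans (measure_mono ?_) h
    intro z hz i hi j hj heq
    apply hz
    have hle : ∀ i < N, 2 * L * i + 2 * L ≤ 2 * L * N := fun i hi =>
      calc 2 * L * i + 2 * L = 2 * L * (i + 1) := by ring
          _ ≤ _ := Nat.mul_le_mul_left _ hi
    have := hle i hi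
    have := hle j hj
    exact ⟨2 * L * i, 2 * L * j + o, by omega, by omega, fun m hm => congrFun heq ⟨m, hm⟩⟩
  have hsp : ∀ S, ((NM r π).prod (NM r π)) S =
      ENNReal.ofReal (π true) * (ENNReal.ofReal (π true) * ((QM r true).prod (QM r true)) S +
        ENNReal.ofReal (π false) * ((QM r true).prod (QM r false)) S) +
      ENNReal.ofReal (π false) * (ENNReal.ofReal (π true) * ((QM r false).prod (QM r true)) S +
        ENNReal.ofReal (π false) * ((QM r false).prod (QM r false)) S) := by
    intro S
    simp only [NM]
    rw [Measure.add_prod, Measure.prod_add, Measure.prod_add]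
    simp only [Measure.prod_smul_left, Measure.prod_smul_right, Measure.add_apply,
      Measure.smul_apply, smul_eq_mul]
    ring
  rw [hsp]
  have hs : ENNReal.ofReal (π true) + ENNReal.ofReal (π false) = 1 := by
    rw [← ENNReal.ofReal_add (hπ _).le (hπ _).le, hπ1]
    simp
  calc _ ≤ ENNReal.ofReal (π true) * (ENNReal.ofReal (π true) * B + ENNReal.ofReal (π false) * B) +
      ENNReal.ofReal (π false) * (ENNReal.ofReal (π true) * B + ENNReal.ofReal (π false) * B) := by
        gcongr <;> exact key _ _
    _ = B := by rw [← add_mul, hs, ← add_mul, hs, one_mul, one_mul]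


theorem rsummable (C d : ℝ) (hd : 0 < d) :
    ∑' k : ℕ, ENNReal.ofReal (C * Real.exp (-(d * k))) ≠ ⊤ := by
  have h : Summable fun k : ℕ => C * Real.exp (-(d * k)) := by
    refine Summable.mul_left _ ?_
    have := Real.summable_exp_neg_nat.comp_injective Function.injective_id
    have h2 : Summable fun k : ℕ => (Real.exp (-d)) ^ k :=
      summable_geometric_of_lt_one (Real.exp_pos _).le (by rw [Real.exp_lt_one_iff]; linarith)
    refine h2.congr fun k => ?_
    rw [← Real.exp_nat_mul]
    congr 1; ring
  exact h.tsum_ofReal_ne_top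

theorem rasym {Ω : Type*} [MeasurableSpace Ω] (P : Measure Ω) (M : Ω → ℕ → ℕ)
    (hmono : ∀ ω, Monotone (M ω)) (σ : ℝ) (hσ0 : 0 < σ) (hσ1 : σ < 1)
    (hup : ∀ n L : ℕ, P {ω | 2 * L ≤ M ω n} ≤ ENNReal.ofReal (8 * (n + 1) ^ 2 * σ ^ L))
    (hlow : ∀ n L N : ℕ, 0 < N → 2 * L * N + 1 ≤ n → P {ω | M ω n < 2 * L} ≤
      ENNReal.ofReal (2 / (N * √(σ ^ L)) + 1 / (N * √(σ ^ L)) ^ 2)) :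
    ∀ᵐ ω ∂P, Tendsto (fun n : ℕ => (M ω n : ℝ) / Real.log n) atTop (𝓝 (4 / -Real.log σ)) := by
  set c := -Real.log σ with hc
  have hc0 : 0 < c := by
    have := Real.log_neg hσ0 hσ1
    linarith
  have hpow : ∀ L : ℕ, σ ^ L = Real.exp (-(c * L)) := by
    intro L
    rw [hc, ← Real.exp_log hσ0, ← Real.exp_nat_mul, Real.log_exp]
    congr 1; ring
  set l := Real.log 2 with hl
  have hl0 : 0 < l := Real.log_pos (by norm_num)
  have h2pow : ∀ k : ℕ, (2 : ℝ) ^ k = Real.exp (k * l) := by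
    intro k
    rw [Real.exp_nat_mul, hl, Real.exp_log (by norm_num)]
  have hlogtop : Tendsto (fun n : ℕ => Real.log n) atTop atTop :=
    Real.tendsto_log_atTop.comp tendsto_natCast_atTop_atTop
  have up : ∀ η : ℝ, 0 < η → ∀ᵐ ω ∂P, ∀ᶠ n : ℕ in atTop,
      (M ω n : ℝ) ≤ (4 / c + η) * Real.log n := by
    intro η hη
    set δ := η * c / 4 with hδ
    have hδ0 : 0 < δ := by positivity
    set Lr : ℕ → ℕ := fun k => ⌈(2 + δ) * (k * l) / c⌉₊ with hLr
    have hb : ∀ k : ℕ, P {ω | 2 * Lr k ≤ M ω (2 ^ k)} ≤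
        ENNReal.ofReal (32 * Real.exp (-((δ * l) * k))) := by
      intro k
      refine (hup _ _).trans (ENNReal.ofReal_le_ofReal ?_)
      have e1 : (2 + δ) * (k * l) ≤ c * Lr k := by
        have := Nat.le_ceil ((2 + δ) * (k * l) / c)
        rw [div_le_iff₀ hc0] at this
        linarith
      have e2 : ((2 ^ k : ℕ) + 1 : ℝ) ^ 2 ≤ 4 * Real.exp (2 * (k * l)) := by
        have : Real.exp (2 * (k * l)) = (2 ^ k) ^ 2 := by
          rw [h2pow, ← Real.exp_nat_mul]
          norm_num
        rw [this]
        push_cast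
        have : (1 : ℝ) ≤ 2 ^ k := one_le_pow₀ (by norm_num)
        nlinarith
      have e3 : σ ^ Lr k ≤ Real.exp (-((2 + δ) * (k * l))) := by
        rw [hpow]
        exact Real.exp_le_exp.2 (by linarith)
      calc 8 * ((2 ^ k : ℕ) + 1 : ℝ) ^ 2 * σ ^ Lr k
          ≤ 8 * (4 * Real.exp (2 * (k * l))) * Real.exp (-((2 + δ) * (k * l))) := by gcongr
        _ = 32 * (Real.exp (2 * (k * l)) * Real.exp (-((2 + δ) * (k * l)))) := by ring
        _ = 32 * Real.exp (-((δ * l) * k)) := by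
          rw [← Real.exp_add]
          congr 2; ring
    have hsum : ∑' k, P {ω | 2 * Lr k ≤ M ω (2 ^ k)} ≠ ⊤ :=
      ne_top_of_le_ne_top (rsummable 32 (δ * l) (by positivity)) (ENNReal.tsum_le_tsum hb)
    filter_upwards [ae_eventually_notMem hsum] with ω hω
    set kr : ℕ → ℕ := fun n => ⌈Real.log n / l⌉₊ with hkr
    have hkt : Tendsto kr atTop atTop :=
      tendsto_nat_ceil_atTop.comp (hlogtop.atTop_div_const hl0)
    have hev := hlogtop.eventually_ge_atTop ((2 * (2 + δ) * l / c + 2) / (η / 2))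
    filter_upwards [hkt.eventually hω, hev, hlogtop.eventually_ge_atTop 0,
      eventually_ge_atTop 1] with n h1 h2 h3 h4
    have h1' : M ω (2 ^ kr n) < 2 * Lr (kr n) := by simpa using h1
    have hn0 : (0 : ℝ) < n := by exact_mod_cast h4
    have hn : n ≤ 2 ^ kr n := by
      have : (n : ℝ) ≤ 2 ^ kr n := by
        rw [h2pow, ← Real.log_le_iff_le_exp hn0]
        exact (div_le_iff₀ hl0).1 (Nat.le_ceil (Real.log n / l))
      exact_mod_cast this
    have h5 : (M ω n : ℝ) ≤ 2 * Lr (kr n) := by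
      have := (hmono ω hn).trans h1'.le
      exact_mod_cast this
    have h6 : (kr n : ℝ) * l ≤ Real.log n + l := by
      have : (kr n : ℝ) < Real.log n / l + 1 := Nat.ceil_lt_add_one (by positivity)
      calc (kr n : ℝ) * l ≤ (Real.log n / l + 1) * l := by gcongr
        _ = _ := by field_simp
    have h7 : (Lr (kr n) : ℝ) ≤ (2 + δ) * (kr n * l) / c + 1 :=
      (Nat.ceil_lt_add_one (by positivity)).le
    have h8 : (2 + δ) * (kr n * l) / c ≤ (2 + δ) * (Real.log n + l) / c := by gcongr
    have h9 := (div_le_iff₀ (by positivity)).1 h2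
    have h10 : 2 * ((2 + δ) * (Real.log n + l) / c) =
        (4 / c + η / 2) * Real.log n + 2 * (2 + δ) * l / c := by
      rw [hδ]
      field_simp
      ring
    nlinarith
  have low : ∀ η : ℝ, 0 < η → ∀ᵐ ω ∂P, ∀ᶠ n : ℕ in atTop,
      (4 / c - η) * Real.log n ≤ (M ω n : ℝ) := by
    intro η hη
    set δ := min (1 / 2) (η * c / 12) with hδ
    have hδ0 : 0 < δ := lt_min (by norm_num) (by positivity)
    have hδ1 : δ ≤ 1 / 2 := min_le_left _ _
    have hδ2 : δ ≤ η * c / 12 := min_le_right _ _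
    set Lr : ℕ → ℕ := fun k => ⌊(2 - δ) * (k * l) / c⌋₊ with hLr
    have hLle : ∀ k : ℕ, (Lr k : ℝ) ≤ (2 - δ) * (k * l) / c := fun k =>
      Nat.floor_le (div_nonneg (mul_nonneg (by linarith) (by positivity)) hc0.le)
    have hb : ∀ k : ℕ, P {ω | M ω (2 * Lr k * 2 ^ k + 1) < 2 * Lr k} ≤
        ENNReal.ofReal (3 * Real.exp (-((δ * l / 2) * k))) := by
      intro k
      refine (hlow _ _ (2 ^ k) (by positivity) le_rfl).trans (ENNReal.ofReal_le_ofReal ?_)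
      have e1 : √(σ ^ Lr k) = Real.exp (-(c * Lr k) / 2) := by
        rw [hpow, Real.exp_half]
      have e2 : Real.exp ((δ * l / 2) * k) ≤ ((2 ^ k : ℕ) : ℝ) * √(σ ^ Lr k) := by
        push_cast
        rw [e1, h2pow, ← Real.exp_add, Real.exp_le_exp]
        have := (le_div_iff₀ hc0).1 (hLle k)
        nlinarith
      set κ := ((2 ^ k : ℕ) : ℝ) * √(σ ^ Lr k)
      set ε := Real.exp ((δ * l / 2) * k) with hε
      have hε1 : 1 ≤ ε := Real.one_le_exp (by positivity)
      rw [Real.exp_neg, ← hε]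
      have e3 : 1 / κ ≤ 1 / ε := one_div_le_one_div_of_le (by linarith) e2
      have e4 : 1 / ε ≤ 1 := by rw [div_le_one (by linarith)]; exact hε1
      have e5 : 0 < 1 / κ := one_div_pos.2 (by linarith)
      have e6 : 2 / κ + 1 / κ ^ 2 = 2 * (1 / κ) + (1 / κ) ^ 2 := by
        field_simp
      rw [e6, inv_eq_one_div]
      nlinarith
    have hsum : ∑' k, P {ω | M ω (2 * Lr k * 2 ^ k + 1) < 2 * Lr k} ≠ ⊤ :=
      ne_top_of_le_ne_top (rsummable 3 (δ * l / 2) (by positivity)) (ENNReal.tsum_le_tsum hb)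
    filter_upwards [ae_eventually_notMem hsum] with ω hω
    set kr : ℕ → ℕ := fun n => ⌊(1 - δ) * Real.log n / l⌋₊ with hkr
    have hkt : Tendsto kr atTop atTop :=
      tendsto_nat_floor_atTop.comp ((hlogtop.const_mul_atTop (by linarith)).atTop_div_const hl0)
    have hev := hlogtop.eventually_ge_atTop ((2 * (2 - δ) * l / c + 2) / (η / 2))
    have hlo : ∀ᶠ n : ℕ in atTop, 4 / c * Real.log n + 1 ≤ (n : ℝ) ^ δ := by
      have h1 := (isLittleO_log_rpow_atTop hδ0).const_mul_left (4 / c)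
      have h2 : (fun _ : ℝ => (1 : ℝ)) =o[atTop] fun x => x ^ δ :=
        Asymptotics.isLittleO_const_left.2 (Or.inr
          (tendsto_norm_atTop_atTop.comp (tendsto_rpow_atTop hδ0)))
      have h3 := (h1.add h2).bound (show (0 : ℝ) < 1 by norm_num)
      have h4 := tendsto_natCast_atTop_atTop (R := ℝ) |>.eventually h3
      filter_upwards [h4] with n hn
      rw [one_mul, Real.norm_of_nonneg (by positivity : (0 : ℝ) ≤ (n : ℝ) ^ δ)] at hn
      exact (le_abs_self _).trans hn
    filter_upwards [hkt.eventually hω, hev, hlogtop.eventually_ge_atTop 0,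
      eventually_ge_atTop 1, hlo] with n h1 h2 h3 h4 h5
    have h1' : 2 * Lr (kr n) ≤ M ω (2 * Lr (kr n) * 2 ^ kr n + 1) := by simpa using h1
    have hn0 : (0 : ℝ) < n := by exact_mod_cast h4
    have hkl : (kr n : ℝ) * l ≤ (1 - δ) * Real.log n :=
      (le_div_iff₀ hl0).1 (Nat.floor_le (div_nonneg (mul_nonneg (by linarith) h3) hl0.le))
    have hkg : (1 - δ) * Real.log n - l ≤ (kr n : ℝ) * l := by
      have : (1 - δ) * Real.log n / l < kr n + 1 := Nat.lt_floor_add_one _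
      rw [div_lt_iff₀ hl0] at this
      linarith
    have hn : 2 * Lr (kr n) * 2 ^ kr n + 1 ≤ n := by
      have a1 : (2 : ℝ) ^ kr n ≤ (n : ℝ) ^ (1 - δ) := by
        rw [h2pow, Real.rpow_def_of_pos hn0, Real.exp_le_exp]
        linarith
      have a2 : (1 : ℝ) ≤ (n : ℝ) ^ (1 - δ) :=
        Real.one_le_rpow (by exact_mod_cast h4) (by linarith)
      have a3 : 2 * (Lr (kr n) : ℝ) ≤ 4 / c * Real.log n := by
        have b1 : (2 - δ) * (kr n * l) / c ≤ 2 * Real.log n / c := by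
          have : (0 : ℝ) ≤ kr n * l := by positivity
          gcongr
          · linarith
          · nlinarith
        have := hLle (kr n)
        have b2 : 4 / c * Real.log n = 2 * (2 * Real.log n / c) := by ring
        linarith
      have a4 : (n : ℝ) ^ δ * (n : ℝ) ^ (1 - δ) = n := by
        rw [← Real.rpow_add hn0]
        simp
      have : (2 * Lr (kr n) * 2 ^ kr n + 1 : ℝ) ≤ n := by
        calc (2 * Lr (kr n) * 2 ^ kr n + 1 : ℝ)
            ≤ (4 / c * Real.log n) * (n : ℝ) ^ (1 - δ) + (n : ℝ) ^ (1 - δ) := by gcongr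
          _ = (4 / c * Real.log n + 1) * (n : ℝ) ^ (1 - δ) := by ring
          _ ≤ (n : ℝ) ^ δ * (n : ℝ) ^ (1 - δ) := by gcongr
          _ = n := a4
      exact_mod_cast this
    have h6 : 2 * (Lr (kr n) : ℝ) ≤ M ω n := by
      have := h1'.trans (hmono ω hn)
      exact_mod_cast this
    have h7 : (2 - δ) * (kr n * l) / c < (Lr (kr n) : ℝ) + 1 := Nat.lt_floor_add_one _
    have h8 : (2 - δ) * ((1 - δ) * Real.log n - l) / c ≤ (2 - δ) * (kr n * l) / c := by
      have : 0 ≤ 2 - δ := by linarith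
      gcongr
    have h9 := (div_le_iff₀ (by positivity)).1 h2
    have h10 : (4 / c - η / 2) * Real.log n - 2 * (2 - δ) * l / c ≤
        2 * ((2 - δ) * ((1 - δ) * Real.log n - l) / c) := by
      have b : 2 * ((2 - δ) * ((1 - δ) * Real.log n - l) / c) -
          ((4 / c - η / 2) * Real.log n - 2 * (2 - δ) * l / c) =
          (η * c / 2 - 6 * δ + 2 * δ ^ 2) * Real.log n / c := by
        field_simp
        ring
      have : 0 ≤ (η * c / 2 - 6 * δ + 2 * δ ^ 2) * Real.log n / c :=
        div_nonneg (mul_nonneg (by nlinarith) h3) hc0.le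
      linarith
    nlinarith
  have hup' : ∀ᵐ ω ∂P, ∀ j : ℕ, ∀ᶠ n : ℕ in atTop,
      (M ω n : ℝ) ≤ (4 / c + 1 / (j + 1)) * Real.log n :=
    ae_all_iff.2 fun j => up _ (by positivity)
  have hlow' : ∀ᵐ ω ∂P, ∀ j : ℕ, ∀ᶠ n : ℕ in atTop,
      (4 / c - 1 / (j + 1)) * Real.log n ≤ (M ω n : ℝ) :=
    ae_all_iff.2 fun j => low _ (by positivity)
  filter_upwards [hup', hlow'] with ω h1 h2
  rw [Metric.tendsto_atTop']
  intro ε hε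
  obtain ⟨j, hj⟩ := exists_nat_one_div_lt hε
  have := (h1 j).and ((h2 j).and (hlogtop.eventually_gt_atTop 0))
  obtain ⟨n₀, hn₀⟩ := eventually_atTop.1 this
  refine ⟨n₀, fun n hn => ?_⟩
  obtain ⟨a1, a2, a3⟩ := hn₀ n hn.le
  rw [Real.dist_eq, abs_lt]
  have b1 := (div_le_iff₀ a3).2 a1
  have b2 := (le_div_iff₀ a3).2 a2
  constructor <;> linarith

/-- Example `exmark1`: for the stationary two-state Markov measure
(`p_{aa} = p`, `p_{bb} = q`, `0 < p,q < 1`), for `μ ⊗ μ`-a.e. `(x,y)`,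
`lim_n M^RLE_n(x,y)/log n = 4/log((1+p)(1+q)/((1-p)(1-q)))`. -/
theorem stmt16 (p q : ℝ) (hp0 : 0 < p) (hp1 : p < 1) (hq0 : 0 < q) (hq1 : q < 1)
    (μ : Measure (ℕ → Bool)) [IsProbabilityMeasure μ]
    (hμ : ∀ (n : ℕ) (w : Fin (n + 1) → Bool),
      μ {x | ∀ i : Fin (n + 1), x i = w i} =
        ENNReal.ofReal
          ((if w 0 then (1 - q) / (2 - p - q) else (1 - p) / (2 - p - q)) *
            ∏ i : Fin n,
              if w i.castSucc then (if w i.succ then p else 1 - p)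
              else (if w i.succ then 1 - q else q))) :
    ∀ᵐ z ∂(μ.prod μ),
      Tendsto (fun n : ℕ => (MRLE z.1 z.2 n : ℝ) / Real.log n) atTop
        (𝓝 (4 / Real.log ((1 + p) * (1 + q) / ((1 - p) * (1 - q))))) := by
  set r : Bool → ℝ := fun b => if b then p else q with hr
  set π : Bool → ℝ := fun b => if b then (1 - q) / (2 - p - q) else (1 - p) / (2 - p - q) with hπdef
  have h0 : ∀ a, 0 < r a := by intro a; cases a <;> simp [hr, hp0, hq0]
  have h1 : ∀ a, r a < 1 := by intro a; cases a <;> simp [hr, hp1, hq1]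
  have hd : 0 < 2 - p - q := by linarith
  have hπ : ∀ a, 0 < π a := by
    intro a
    cases a
    · simp only [hπdef]
      exact div_pos (by linarith) hd
    · simp only [hπdef]
      exact div_pos (by linarith) hd
  have hπ1 : π true + π false = 1 := by
    simp only [hπdef, if_true, Bool.false_eq_true, if_false]
    rw [← add_div, div_eq_one_iff_eq hd.ne']
    ring
  have hμ' : ∀ (n : ℕ) (d : ℕ → Bool), μ {x | ∀ t ≤ n, x t = d t} =
      ENNReal.ofReal (π (d 0) * ∏ t ∈ Finset.range n,
        (if d t = d (t + 1) then r (d t) else 1 - r (d t))) := by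
    intro n d
    have h := hμ n (fun i => d i)
    have e1 : {x : ℕ → Bool | ∀ t ≤ n, x t = d t} = {x | ∀ i : Fin (n + 1), x i = d i} := by
      ext x
      constructor
      · intro hx i
        exact hx i (by omega)
      · intro hx t ht
        exact hx ⟨t, by omega⟩
    rw [e1, h, ← Fin.prod_univ_eq_prod_range
      (fun t => if d t = d (t + 1) then r (d t) else 1 - r (d t))]
    congr 2
    refine Finset.prod_congr rfl fun i _ => ?_
    simp only [Fin.val_castSucc, Fin.val_succ, hr]
    rcases Bool.eq_false_or_eq_true (d i) with h1 | h1 <;> rcases Bool.eq_false_or_eq_true (d (i + 1)) with h2 | h2 <;> simp [h1, h2]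
  have hlaw := rlaw r π h0 h1 hπ hπ1 μ hμ'
  have hmap : (μ.prod μ).map (Prod.map (fun x => rle x) (fun x => rle x)) =
      (NM r π).prod (NM r π) := by
    rw [← hlaw, Measure.map_prod_map _ _ measurable_rle measurable_rle]
  have hle : ∀ S, (μ.prod μ) (Prod.map (fun x => rle x) (fun x => rle x) ⁻¹' S) ≤
      ((NM r π).prod (NM r π)) S := by
    intro S
    rw [← hmap]
    exact Measure.le_map_apply (measurable_rle.prodMap measurable_rle).aemeasurable S
  set σ := (1 - p) * (1 - q) / ((1 + p) * (1 + q)) with hσ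
  have hσr : (1 - r true) * (1 - r false) / ((1 + r true) * (1 + r false)) = σ := by
    simp [hr, hσ]
  have hσ0 : 0 < σ := div_pos (mul_pos (by linarith) (by linarith))
    (mul_pos (by linarith) (by linarith))
  have hσ1 : σ < 1 := by
    rw [hσ, div_lt_one (mul_pos (by linarith) (by linarith))]
    nlinarith
  have hlim : Real.log ((1 + p) * (1 + q) / ((1 - p) * (1 - q))) = -Real.log σ := by
    rw [← Real.log_inv, hσ, inv_div]
  rw [hlim]
  refine rasym (μ.prod μ) (fun z n => MRLE z.1 z.2 n) (fun z n n' h => matchLen_mono _ _ h)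
    σ hσ0 hσ1 ?_ ?_
  · intro n L
    have h := rprob_up r π h0 h1 hπ hπ1 n L
    rw [hσr] at h
    refine le_trans (le_trans (measure_mono ?_) (hle _)) h
    intro z hz
    exact (le_matchLen_iff _ _ _ _).1 hz
  · intro n L N hN hn
    have h := rprob_low r π h0 h1 hπ hπ1 n L N hN hn
    rw [hσr] at h
    refine le_trans (le_trans (measure_mono ?_) (hle _)) h
    intro z hz hz'
    exact absurd ((le_matchLen_iff _ _ _ _).2 hz') (not_le.2 hz)
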